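/- Let n+s be odd with 0 ≤ s ≤ n−5 and f ∈ WRP with sign ε and dual g. Then the code C_{D_f} with defining set D_f = {x ∈ F_q^* : f(x) = 0} is a minimal linear code with parameters [p^{n−1} − 1, n, (p−1)(p^{n−2} − p^{(n+s−3)/2})]_p; in particular every nonzero codeword of C_{D_f} is minimal. -/

import Mathlib

open scoped BigOperators Classical

noncomputable section

/-- `ξ_p^j` for `j : ZMod p`, where `ξ_p = exp(2πi/p)` and the exponent `j`
is lifted to a natural number. -/
def ep (p : ℕ) (j : ZMod p) : ℂ :=
  Complex.exp (2 * Real.pi * Complex.I * (j.val : ℂ) / (p : ℂ))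

/-- `√(p*)`: equal to `√p` if `p ≡ 1 (mod 4)` and to `i√p` if `p ≡ 3 (mod 4)`. -/
def sqrtPStar (p : ℕ) : ℂ :=
  if p % 4 = 1 then ((Real.sqrt p : ℝ) : ℂ) else Complex.I * ((Real.sqrt p : ℝ) : ℂ)

/-- The quadratic character `η₀` of `F_p` (extended by `η₀(0) = 0`), with values in `ℂ`. -/
def eta0 (p : ℕ) [Fact p.Prime] (j : ZMod p) : ℂ :=
  ((quadraticChar (ZMod p) j : ℤ) : ℂ)

/-- The Walsh transform of `f : F_q → F_p`. -/
def walsh (p : ℕ) {F : Type*} [Field F] [Fintype F] [Algebra (ZMod p) F]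
    (f : F → ZMod p) (β : F) : ℂ :=
  ∑ x : F, ep p (f x - Algebra.trace (ZMod p) F (β * x))

/-- `f` is weakly regular `s`-plateaued with sign `ε` and dual `g`:
`W_f(β) = ε √(p*)^{n+s} ξ_p^{g(β)}` on the Walsh support, `W_f(β) = 0` off it,
and `g` vanishes off the Walsh support. -/
def IsWeaklyRegularPlateaued (p n s : ℕ) {F : Type*} [Field F] [Fintype F]
    [Algebra (ZMod p) F] (f : F → ZMod p) (ε : ℂ) (g : F → ZMod p) : Prop :=
  (ε = 1 ∨ ε = -1) ∧
  (∀ β : F, walsh p f β ≠ 0 →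
      walsh p f β = ε * sqrtPStar p ^ (n + s) * ep p (g β)) ∧
  (∀ β : F, walsh p f β = 0 → g β = 0)

/-- `f` lies in the class `WRP`: weakly regular `s`-plateaued with sign `ε` and dual `g`,
unbalanced, `f(0) = 0`, and `f(ax) = a^h f(x)` for some positive even `h` with
`gcd(h-1, p-1) = 1`. -/
def IsWRP (p n s : ℕ) {F : Type*} [Field F] [Fintype F]
    [Algebra (ZMod p) F] (f : F → ZMod p) (ε : ℂ) (g : F → ZMod p) : Prop :=
  IsWeaklyRegularPlateaued p n s f ε g ∧
  walsh p f 0 ≠ 0 ∧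
  f 0 = 0 ∧
  ∃ h : ℕ, 0 < h ∧ Even h ∧ Nat.gcd (h - 1) (p - 1) = 1 ∧
    ∀ (a : (ZMod p)ˣ) (x : F),
      f (algebraMap (ZMod p) F (a : ZMod p) * x) = (a : ZMod p) ^ h * f x

/-- The defining set `D_f = {x ∈ F_q^* : f(x) = 0}`. -/
def Dzero (p : ℕ) {F : Type*} [Field F] [Fintype F] [Algebra (ZMod p) F]
    (f : F → ZMod p) : Finset F :=
  Finset.univ.filter fun x => x ≠ 0 ∧ f x = 0

/-- The defining set `D_{f,sq} = {x ∈ F_q : f(x) ∈ SQ}`. -/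
def Dsq (p : ℕ) {F : Type*} [Field F] [Fintype F] [Algebra (ZMod p) F]
    (f : F → ZMod p) : Finset F :=
  Finset.univ.filter fun x => f x ≠ 0 ∧ IsSquare (f x)

/-- The defining set `D_{f,nsq} = {x ∈ F_q : f(x) ∈ NSQ}`. -/
def Dnsq (p : ℕ) {F : Type*} [Field F] [Fintype F] [Algebra (ZMod p) F]
    (f : F → ZMod p) : Finset F :=
  Finset.univ.filter fun x => f x ≠ 0 ∧ ¬ IsSquare (f x)

/-- The codeword `c_β = (Tr(βd))_{d ∈ D}` of the code `C_D`. -/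
def cword (p : ℕ) {F : Type*} [Field F] [Fintype F] [Algebra (ZMod p) F]
    (D : Finset F) (β : F) : D → ZMod p :=
  fun d => Algebra.trace (ZMod p) F (β * (d : F))

/-- The Hamming weight of the codeword `c_β` of the code `C_D`. -/
def wtOn (p : ℕ) {F : Type*} [Field F] [Fintype F] [Algebra (ZMod p) F]
    (D : Finset F) (β : F) : ℕ :=
  (D.filter fun d => Algebra.trace (ZMod p) F (β * d) ≠ 0).card

/-- `u` covers `v` : the support of `v` is contained in the support of `u`. -/
def Covers {k : ℕ} {ι : Type*} (u v : ι → ZMod k) : Prop :=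
  ∀ i, v i ≠ 0 → u i ≠ 0

/-- The code `C_D` is minimal: every nonzero codeword covers only its own
nonzero scalar multiples among the nonzero codewords. -/
def IsMinimalCode (p : ℕ) {F : Type*} [Field F] [Fintype F] [Algebra (ZMod p) F]
    (D : Finset F) : Prop :=
  ∀ β : F, cword p D β ≠ 0 →
    ∀ β' : F, cword p D β' ≠ 0 → Covers (cword p D β) (cword p D β') →
      ∃ a : ZMod p, a ≠ 0 ∧ cword p D β' = a • cword p D β

/-- The code `C_D` is an `[m, n, d]_p` code: length `m`, dimension `n`
(i.e. `β ↦ c_β` is injective, so the code has `p^n` codewords), and minimum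
nonzero Hamming weight `d`. -/
def HasParams (p : ℕ) {F : Type*} [Field F] [Fintype F] [Algebra (ZMod p) F]
    (D : Finset F) (m d : ℤ) : Prop :=
  (D.card : ℤ) = m ∧
  Function.Injective (cword p D) ∧
  (∀ β : F, cword p D β ≠ 0 → d ≤ (wtOn p D β : ℤ)) ∧
  (∃ β : F, cword p D β ≠ 0 ∧ (wtOn p D β : ℤ) = d)

/-- The number of solutions of `f x - Tr(βx) = c`. -/
def solCount (p : ℕ) {F : Type*} [Field F] [Fintype F] [Algebra (ZMod p) F]
    (f : F → ZMod p) (β : F) (c : ZMod p) : ℕ :=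
  (Finset.univ.filter fun x => f x - Algebra.trace (ZMod p) F (β * x) = c).card

theorem ep_eq_stdAddChar (p : ℕ) [NeZero p] (j : ZMod p) : ep p j = ZMod.stdAddChar j := by
  rw [ZMod.stdAddChar_apply, ZMod.toCircle_apply, ep]

theorem ep_eq_pow (p : ℕ) [NeZero p] (j : ZMod p) :
    ep p j = Complex.exp (2 * Real.pi * Complex.I / p) ^ j.val := by
  rw [← Complex.exp_nat_mul, ep]
  congr 1
  ring

/-- A vanishing integral combination of all the `p`-th roots of unity has equal coefficients. -/
theorem eq_of_sum_mul_ep_eq_zero (p : ℕ) [Fact p.Prime] (a : ZMod p → ℤ)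
    (h : ∑ c, (a c : ℂ) * ep p c = 0) (c d : ZMod p) : a c = a d := by
  open Polynomial in
  have hp : p.Prime := Fact.out
  have hprim := Complex.isPrimitiveRoot_exp p hp.ne_zero
  set P : ℤ[X] := ∑ c : ZMod p, C (a c) * X ^ c.val with hP
  have hcoeff : ∀ c : ZMod p, P.coeff c.val = a c := by
    intro c
    simp only [hP, finsetSum_coeff, coeff_C_mul, coeff_X_pow]
    rw [Finset.sum_eq_single c]
    · simp
    · intro b _ hb
      rw [if_neg fun h => hb (ZMod.val_injective p h).symm, mul_zero]
    · simp
  have hdeg : P.natDegree ≤ p - 1 := by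
    refine natDegree_sum_le_of_forall_le _ _ fun c _ => ?_
    refine (natDegree_C_mul_X_pow_le _ _).trans ?_
    have := ZMod.val_lt c
    omega
  have hdvd : cyclotomic p ℤ ∣ P := by
    rw [cyclotomic_eq_minpoly hprim hp.pos]
    refine minpoly.isIntegrallyClosed_dvd (hprim.isIntegral hp.pos) ?_
    rw [hP, map_sum, ← h]
    refine Finset.sum_congr rfl fun c _ => ?_
    simp [ep_eq_pow]
  obtain ⟨Q, hQ⟩ := hdvd
  have hQ0 : Q.natDegree = 0 := by
    by_cases hz : Q = 0
    · simp [hz]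
    · have := (cyclotomic.monic p ℤ).natDegree_mul' hz
      rw [← hQ, natDegree_cyclotomic, Nat.totient_prime hp] at this
      omega
  obtain ⟨q, rfl⟩ := natDegree_eq_zero.mp hQ0
  have key : ∀ c : ZMod p, a c = q := by
    intro c
    rw [← hcoeff, hQ, coeff_mul_C, cyclotomic_prime]
    simp [coeff_X_pow, ZMod.val_lt c]
  rw [key, key]

theorem sqrtPStar_sq (p : ℕ) [Fact p.Prime] (hp : p ≠ 2) :
    sqrtPStar p ^ 2 = ((quadraticChar (ZMod p) (-1) : ℤ) : ℂ) * p := by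
  have h2 : p % 2 = 1 := (Fact.out : p.Prime).eq_two_or_odd.resolve_left hp
  have hr : (((Real.sqrt p : ℝ) : ℂ)) ^ 2 = p := by
    rw [← Complex.ofReal_pow, Real.sq_sqrt (Nat.cast_nonneg p)]
    simp
  rw [quadraticChar_neg_one (by rwa [ZMod.ringChar_zmod_n]), ZMod.card, sqrtPStar]
  split_ifs with h
  · rw [hr, ZMod.χ₄_nat_one_mod_four h]
    simp
  · rw [mul_pow, hr, ZMod.χ₄_nat_three_mod_four (by omega)]
    simp

/-- `√(p*)` agrees up to sign with the quadratic Gauss sum. -/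
theorem sqrtPStar_eq_or (p : ℕ) [Fact p.Prime] (hp : p ≠ 2) :
    ∃ δ : ℤ, (δ = 1 ∨ δ = -1) ∧
      sqrtPStar p = δ * ∑ c : ZMod p, ((quadraticChar (ZMod p) c : ℤ) : ℂ) * ep p c := by
  have hc : ringChar (ZMod p) ≠ 2 := by rwa [ZMod.ringChar_zmod_n]
  have hG := gaussSum_sq (R := ZMod p) (R' := ℂ)
    (χ := (quadraticChar (ZMod p)).ringHomComp (Int.castRingHom ℂ))
    ((MulChar.ringHomComp_ne_one_iff Int.cast_injective).mpr (quadraticChar_ne_one hc))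
    ((quadraticChar_isQuadratic (ZMod p)).comp _) (ZMod.isPrimitive_stdAddChar p)
  have hG' : gaussSum ((quadraticChar (ZMod p)).ringHomComp (Int.castRingHom ℂ))
      (ZMod.stdAddChar (N := p)) =
        ∑ c : ZMod p, ((quadraticChar (ZMod p) c : ℤ) : ℂ) * ep p c := by
    simp [gaussSum, ep_eq_stdAddChar]
  rw [hG'] at hG
  have hs := sqrtPStar_sq p hp
  have : sqrtPStar p ^ 2 =
      (∑ c : ZMod p, ((quadraticChar (ZMod p) c : ℤ) : ℂ) * ep p c) ^ 2 := by
    rw [hs, hG, ZMod.card]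
    simp
  rcases sq_eq_sq_iff_eq_or_eq_neg.mp this with h | h
  · exact ⟨1, Or.inl rfl, by simpa using h⟩
  · exact ⟨-1, Or.inr rfl, by simpa using h⟩

theorem walsh_eq_sum_solCount (p : ℕ) [Fact p.Prime] {F : Type*} [Field F] [Fintype F]
    [Algebra (ZMod p) F] (f : F → ZMod p) (β : F) :
    walsh p f β = ∑ c, ((solCount p f β c : ℤ) : ℂ) * ep p c := by
  rw [walsh, ← Finset.sum_fiberwise Finset.univ
    (fun x => f x - Algebra.trace (ZMod p) F (β * x))]
  refine Finset.sum_congr rfl fun c _ => ?_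
  rw [Finset.sum_congr rfl (g := fun _ => ep p c)
    (fun x hx => by rw [(Finset.mem_filter.mp hx).2]), Finset.sum_const, solCount]
  simp

theorem sum_solCount (p : ℕ) [Fact p.Prime] {F : Type*} [Field F] [Fintype F]
    [Algebra (ZMod p) F] (f : F → ZMod p) (β : F) :
    ∑ c, solCount p f β c = Fintype.card F :=
  (Finset.card_eq_sum_card_fiberwise fun _ _ => Finset.mem_univ _).symm

/-- The solution counts, when their exponential sum is that of `b` and `b` has total zero. -/
theorem solCount_eq_of_walsh_eq (p n : ℕ) [Fact p.Prime] (hn : 0 < n) {F : Type*} [Field F]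
    [Fintype F] [Algebra (ZMod p) F] (hq : Fintype.card F = p ^ n) (f : F → ZMod p) (β : F)
    (b : ZMod p → ℤ) (hb : ∑ c, b c = 0)
    (h : walsh p f β = ∑ c, (b c : ℂ) * ep p c) (c : ZMod p) :
    (solCount p f β c : ℤ) = (p : ℤ) ^ (n - 1) + b c := by
  have hp : p.Prime := Fact.out
  have h0 : ∑ c, (((solCount p f β c - b c : ℤ)) : ℂ) * ep p c = 0 := by
    simp only [Int.cast_sub, sub_mul, Finset.sum_sub_distrib]
    rw [← h, ← walsh_eq_sum_solCount, sub_self]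
  have heq := eq_of_sum_mul_ep_eq_zero p _ h0
  have hsum : ∑ d, ((solCount p f β d : ℤ) - b d) = p ^ n := by
    rw [Finset.sum_sub_distrib, hb, sub_zero]
    exact_mod_cast (sum_solCount p f β).trans hq
  rw [Finset.sum_congr rfl fun d _ => heq d c, Finset.sum_const, Finset.card_univ, ZMod.card,
    nsmul_eq_mul] at hsum
  have hpn : (p : ℤ) ^ n = p * p ^ (n - 1) := by
    rw [← pow_succ', Nat.sub_add_cancel hn]
  rw [hpn] at hsum
  have := mul_left_cancel₀ (by exact_mod_cast hp.ne_zero) hsum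
  linarith

theorem solCount_of_walsh_eq_zero (p n : ℕ) [Fact p.Prime] (hn : 0 < n) {F : Type*} [Field F]
    [Fintype F] [Algebra (ZMod p) F] (hq : Fintype.card F = p ^ n) (f : F → ZMod p) (β : F)
    (h : walsh p f β = 0) (c : ZMod p) :
    (solCount p f β c : ℤ) = (p : ℤ) ^ (n - 1) := by
  simpa using solCount_eq_of_walsh_eq p n hn hq f β 0 (by simp) (by simpa using h) c

theorem solCount_of_walsh_eq (p n m : ℕ) [Fact p.Prime] (hp : p ≠ 2) (hn : 0 < n) {F : Type*}
    [Field F] [Fintype F] [Algebra (ZMod p) F] (hq : Fintype.card F = p ^ n) (f : F → ZMod p)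
    (β : F) (ε : ℂ) (hε : ε = 1 ∨ ε = -1) (g : ZMod p)
    (h : walsh p f β = ε * sqrtPStar p ^ (2 * m + 1) * ep p g) :
    ∃ δ : ℤ, (δ = 1 ∨ δ = -1) ∧ ∀ c, (solCount p f β c : ℤ) =
      (p : ℤ) ^ (n - 1) + δ * p ^ m * quadraticChar (ZMod p) (c - g) := by
  have hc : ringChar (ZMod p) ≠ 2 := by rwa [ZMod.ringChar_zmod_n]
  obtain ⟨δ₁, hδ₁, hs⟩ := sqrtPStar_eq_or p hp
  obtain ⟨δ₂, hδ₂, rfl⟩ : ∃ δ : ℤ, (δ = 1 ∨ δ = -1) ∧ ε = δ := by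
    rcases hε with rfl | rfl
    · exact ⟨1, Or.inl rfl, by simp⟩
    · exact ⟨-1, Or.inr rfl, by simp⟩
  have hδ₃ : quadraticChar (ZMod p) (-1) = 1 ∨ quadraticChar (ZMod p) (-1) = -1 :=
    quadraticChar_dichotomy (by simp)
  set δ₃ : ℤ := quadraticChar (ZMod p) (-1) with h₃
  refine ⟨δ₂ * δ₃ ^ m * δ₁, ?_, fun c => ?_⟩
  · have h₃' : δ₃ ^ m = 1 ∨ δ₃ ^ m = -1 := by
      rcases hδ₃ with h | h <;> rw [h]
      · simp
      · exact neg_one_pow_eq_or ℤ m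
    rcases hδ₁ with h | h <;> rcases hδ₂ with h' | h' <;> rcases h₃' with h'' | h'' <;>
      simp [h, h', h'']
  · refine solCount_eq_of_walsh_eq p n hn hq f β
      (fun c => δ₂ * δ₃ ^ m * δ₁ * p ^ m * quadraticChar (ZMod p) (c - g)) ?_ ?_ c
    · rw [← Finset.mul_sum, show ∑ c, quadraticChar (ZMod p) (c - g) = ∑ c, quadraticChar (ZMod p) c from
        (Equiv.subRight g).sum_comp (fun c => quadraticChar (ZMod p) c),
        quadraticChar_sum_zero hc, mul_zero]
    · rw [h, pow_succ, pow_mul, sqrtPStar_sq p hp, ← h₃, hs]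
      rw [← (Equiv.subRight g).sum_comp, Finset.mul_sum, Finset.mul_sum, Finset.mul_sum,
        Finset.sum_mul]
      refine Finset.sum_congr rfl fun c _ => ?_
      have : ep p c = ep p (c - g) * ep p g := by
        rw [ep_eq_stdAddChar, ep_eq_stdAddChar, ep_eq_stdAddChar, ← AddChar.map_add_eq_mul,
          sub_add_cancel]
      simp only [Equiv.subRight_apply]
      rw [this]
      push_cast
      ring

theorem card_trace_mul_eq (p n : ℕ) [Fact p.Prime] (hn : 0 < n) {F : Type*} [Field F]
    [Fintype F] [Algebra (ZMod p) F] (hq : Fintype.card F = p ^ n) {β : F} (hβ : β ≠ 0)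
    (c : ZMod p) :
    (Finset.univ.filter fun x : F => Algebra.trace (ZMod p) F (β * x) = c).card
      = p ^ (n - 1) := by
  have hp : p.Prime := Fact.out
  have : Module.Finite (ZMod p) F := Module.Finite.of_finite
  let φ : F →+ ZMod p := (Algebra.trace (ZMod p) F).toAddMonoidHom.comp (AddMonoidHom.mulLeft β)
  have hφ : ∀ x, φ x = Algebra.trace (ZMod p) F (β * x) := fun _ => rfl
  have hsurj : Function.Surjective φ := by
    intro d
    obtain ⟨y, hy⟩ := Algebra.trace_surjective (ZMod p) F d
    exact ⟨β⁻¹ * y, by rw [hφ, mul_inv_cancel_left₀ hβ, hy]⟩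
  have hfib : ∀ d, (Finset.univ.filter fun x : F => φ x = d).card
      = (Finset.univ.filter fun x : F => φ x = c).card := fun d =>
    AddMonoidHom.card_fiber_eq_of_mem_range φ (hsurj d) (hsurj c)
  have hsum := Finset.card_eq_sum_card_fiberwise (f := φ) (s := Finset.univ)
    (t := Finset.univ) fun _ _ => Finset.mem_univ _
  rw [Finset.sum_congr rfl fun d _ => hfib d, Finset.sum_const, Finset.card_univ,
    Finset.card_univ, ZMod.card, hq, smul_eq_mul, ← Nat.sub_add_cancel hn, pow_succ'] at hsum
  exact (Nat.eq_of_mul_eq_mul_left hp.pos hsum).symm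

theorem card_trace_mul_ne_zero (p n : ℕ) [Fact p.Prime] (hn : 0 < n) {F : Type*} [Field F]
    [Fintype F] [Algebra (ZMod p) F] (hq : Fintype.card F = p ^ n) {β : F} (hβ : β ≠ 0) :
    ((Finset.univ.filter fun x : F => Algebra.trace (ZMod p) F (β * x) ≠ 0).card : ℤ)
      = p ^ n - p ^ (n - 1) := by
  have h := Finset.card_filter_add_card_filter_not (s := (Finset.univ : Finset F))
    (fun x : F => Algebra.trace (ZMod p) F (β * x) = 0)
  rw [card_trace_mul_eq p n hn hq hβ, Finset.card_univ, hq] at h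
  have h' : ((p ^ (n - 1) + (Finset.univ.filter
    fun x : F => ¬ Algebra.trace (ZMod p) F (β * x) = 0).card : ℕ) : ℤ) = ((p ^ n : ℕ) : ℤ) := by
    rw [h]
  push_cast at h'
  linarith

/-- Double counting of the pairs `(z, x)` with `f x = z Tr(βx)`. -/
theorem sum_solCount_mul (p : ℕ) [Fact p.Prime] {F : Type*} [Field F]
    [Fintype F] [Algebra (ZMod p) F] (f : F → ZMod p) (β : F) :
    ∑ z : ZMod p, solCount p f (algebraMap (ZMod p) F z * β) 0 =
      p * (Finset.univ.filter fun x => f x = 0 ∧ Algebra.trace (ZMod p) F (β * x) = 0).card +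
      (Finset.univ.filter fun x : F => Algebra.trace (ZMod p) F (β * x) ≠ 0).card := by
  have htr : ∀ (z : ZMod p) (x : F), Algebra.trace (ZMod p) F (algebraMap (ZMod p) F z * β * x)
      = z * Algebra.trace (ZMod p) F (β * x) := by
    intro z x
    rw [mul_assoc, ← Algebra.smul_def, map_smul, smul_eq_mul]
  simp only [solCount, htr, Finset.card_filter]
  rw [Finset.sum_comm, Finset.mul_sum, ← Finset.sum_add_distrib]
  refine Finset.sum_congr rfl fun x _ => ?_
  by_cases ht : Algebra.trace (ZMod p) F (β * x) = 0
  · by_cases hx : f x = 0 <;> simp [ht, hx, ZMod.card]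
  · rw [Finset.sum_eq_single (f x / Algebra.trace (ZMod p) F (β * x))]
    · simp [ht]
    · intro z _ hz
      rw [if_neg]
      intro h
      exact hz (by rw [eq_div_iff ht, ← sub_eq_zero.mp h])
    · simp

/-- Double counting of the pairs `(β, x)` with `f x = Tr(βx)`. -/
theorem sum_solCount_zero (p n : ℕ) [Fact p.Prime] (hn : 0 < n) {F : Type*} [Field F]
    [Fintype F] [Algebra (ZMod p) F] (hq : Fintype.card F = p ^ n) (f : F → ZMod p)
    (hf0 : f 0 = 0) :
    ∑ β : F, solCount p f β 0 = p ^ n + (p ^ n - 1) * p ^ (n - 1) := by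
  simp only [solCount, Finset.card_filter]
  rw [Finset.sum_comm, ← Finset.add_sum_erase _ _ (Finset.mem_univ (0 : F))]
  congr 1
  · simp [hf0, hq]
  · rw [Finset.sum_congr rfl (g := fun _ => p ^ (n - 1)), Finset.sum_const,
      Finset.card_erase_of_mem (Finset.mem_univ _), Finset.card_univ, hq, smul_eq_mul]
    intro x hx
    rw [← Finset.card_filter, ← card_trace_mul_eq p n hn hq (Finset.ne_of_mem_erase hx) (f x)]
    congr 1
    ext β
    rw [Finset.mem_filter, Finset.mem_filter, sub_eq_zero, eq_comm, mul_comm]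

theorem exists_lt_solCount (p n : ℕ) [Fact p.Prime] (hn : 0 < n) {F : Type*} [Field F]
    [Fintype F] [Algebra (ZMod p) F] (hq : Fintype.card F = p ^ n) (f : F → ZMod p)
    (hf0 : f 0 = 0) : ∃ β : F, p ^ (n - 1) < solCount p f β 0 := by
  have hp : p.Prime := Fact.out
  by_contra! h
  have hle := Finset.sum_le_card_nsmul Finset.univ _ _ fun β _ => h β
  rw [sum_solCount_zero p n hn hq f hf0, Finset.card_univ, hq, smul_eq_mul] at hle
  have h1 : p ^ (n - 1) < p ^ n := Nat.pow_lt_pow_right hp.one_lt (by omega)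
  have h2 : p ^ n = (p ^ n - 1) + 1 :=
    (Nat.sub_add_cancel (Nat.pow_pos hp.pos)).symm
  nlinarith

/-- Homogeneity makes the solution counts invariant under scaling of `β`. -/
theorem solCount_mul_eq (p h : ℕ) [Fact p.Prime] {F : Type*} [Field F]
    [Fintype F] [Algebra (ZMod p) F] (f : F → ZMod p) (h0 : 0 < h)
    (hgcd : Nat.gcd (h - 1) (p - 1) = 1)
    (hf : ∀ (a : (ZMod p)ˣ) (x : F),
      f (algebraMap (ZMod p) F (a : ZMod p) * x) = (a : ZMod p) ^ h * f x)
    (z : ZMod p) (hz : z ≠ 0) (β : F) :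
    solCount p f (algebraMap (ZMod p) F z * β) 0 = solCount p f β 0 := by
  have hcop : (Nat.card (ZMod p)ˣ).Coprime (h - 1) := by
    rw [Nat.card_eq_fintype_card, ZMod.card_units, Nat.coprime_comm]
    exact hgcd
  obtain ⟨a, ha⟩ := (powCoprime hcop).surjective (Units.mk0 z hz)
  have ha' : (a : ZMod p) ^ (h - 1) = z := by
    have := congrArg Units.val ha
    simpa using this
  have ha0 : algebraMap (ZMod p) F (a : ZMod p) ≠ 0 := by simp
  symm
  unfold solCount
  refine Finset.card_bijective (fun x => algebraMap (ZMod p) F (a : ZMod p) * x)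
    (mulLeft_bijective₀ _ ha0) fun x => ?_
  simp only [Finset.mem_filter, Finset.mem_univ, true_and]
  have htr : Algebra.trace (ZMod p) F (algebraMap (ZMod p) F z * β *
      (algebraMap (ZMod p) F (a : ZMod p) * x)) =
      (a : ZMod p) ^ h * Algebra.trace (ZMod p) F (β * x) := by
    rw [← smul_eq_mul ((a : ZMod p) ^ h), ← map_smul, Algebra.smul_def]
    congr 1
    rw [← Nat.sub_add_cancel h0, pow_succ, ha', map_mul]
    ring
  rw [hf, htr, ← mul_sub, mul_eq_zero, or_iff_right (pow_ne_zero _ a.ne_zero)]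

theorem even_solCount_zero (p : ℕ) [Fact p.Prime] (hp : p ≠ 2) {F : Type*} [Field F]
    [Fintype F] [Algebra (ZMod p) F] (f : F → ZMod p) (hf0 : f 0 = 0)
    (heven : ∀ x, f (-x) = f x) (c : ZMod p) (hc : c ≠ 0) : Even (solCount p f 0 c) := by
  have : CharP F p := charP_of_injective_algebraMap (algebraMap (ZMod p) F).injective p
  have hchar : ringChar F ≠ 2 := by rwa [ringChar.eq F p]
  rw [← ZMod.natCast_eq_zero_iff_even, solCount, Finset.card_eq_sum_ones, Nat.cast_sum]
  refine Finset.sum_involution (fun x _ => -x) (fun _ _ => by decide) (fun x hx _ h => ?_)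
    (fun x hx => ?_) (fun x _ => neg_neg x)
  · have hx0 : x = 0 := Ring.eq_self_iff_eq_zero_of_char_ne_two hchar |>.mp h
    simp only [Finset.mem_filter, zero_mul, map_zero, sub_zero] at hx
    rw [hx0, hf0] at hx
    exact hc hx.2.symm
  · simpa [heven] using hx

theorem solCount_zero_zero (p n m : ℕ) [Fact p.Prime] (hp : p ≠ 2) (hn : 0 < n) {F : Type*}
    [Field F] [Fintype F] [Algebra (ZMod p) F] (hq : Fintype.card F = p ^ n) (f : F → ZMod p)
    (hf0 : f 0 = 0) (heven : ∀ x, f (-x) = f x) (ε : ℂ) (hε : ε = 1 ∨ ε = -1) (g : ZMod p)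
    (h : walsh p f 0 = ε * sqrtPStar p ^ (2 * m + 1) * ep p g) :
    solCount p f 0 0 = p ^ (n - 1) := by
  obtain ⟨δ, -, hδ⟩ := solCount_of_walsh_eq p n m hp hn hq f 0 ε hε g h
  have hg := hδ g
  rw [sub_self, MulChar.map_zero, mul_zero, add_zero] at hg
  have hg' : solCount p f 0 g = p ^ (n - 1) := by exact_mod_cast hg
  by_cases h0 : g = 0
  · rwa [h0] at hg'
  · have := even_solCount_zero p hp f hf0 heven g h0
    rw [hg'] at this
    exact absurd this (Nat.not_even_iff_odd.mpr
      (((Fact.out : p.Prime).odd_of_ne_two hp).pow))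

theorem card_Dzero_add_one (p : ℕ) [Fact p.Prime] {F : Type*} [Field F]
    [Fintype F] [Algebra (ZMod p) F] (f : F → ZMod p) (hf0 : f 0 = 0) :
    (Dzero p f).card + 1 = solCount p f 0 0 := by
  have : Dzero p f = (Finset.univ.filter fun x => f x = 0).erase 0 := by
    ext x
    simp [Dzero]
  rw [this, Finset.card_erase_add_one (by simp [hf0]), solCount]
  simp

theorem wtOn_Dzero_add (p : ℕ) [Fact p.Prime] {F : Type*} [Field F]
    [Fintype F] [Algebra (ZMod p) F] (f : F → ZMod p) (β : F) :
    (Finset.univ.filter fun x => f x = 0 ∧ Algebra.trace (ZMod p) F (β * x) = 0).card +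
      wtOn p (Dzero p f) β = solCount p f 0 0 := by
  have h := Finset.card_filter_add_card_filter_not (s := Finset.univ.filter fun x : F => f x = 0)
    (fun x : F => Algebra.trace (ZMod p) F (β * x) = 0)
  rw [Finset.filter_filter, Finset.filter_filter] at h
  have h1 : solCount p f 0 0 = (Finset.univ.filter fun x : F => f x = 0).card := by
    simp [solCount]
  rw [h1, ← h, wtOn, Dzero, Finset.filter_filter]
  congr 2
  ext x
  simp only [Finset.mem_filter, Finset.mem_univ, true_and, and_assoc]
  refine ⟨fun hx => hx.2, fun hx => ⟨?_, hx⟩⟩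
  rintro rfl
  simp at hx

/-- The weight of `c_β` in terms of the number of solutions of `f x = Tr(βx)`. -/
theorem mul_wtOn_Dzero (p n : ℕ) [Fact p.Prime] (hn : 0 < n) {F : Type*} [Field F]
    [Fintype F] [Algebra (ZMod p) F] (hq : Fintype.card F = p ^ n) (f : F → ZMod p)
    (h00 : solCount p f 0 0 = p ^ (n - 1)) (β : F) (hβ : β ≠ 0)
    (hscale : ∀ z : ZMod p, z ≠ 0 →
      solCount p f (algebraMap (ZMod p) F z * β) 0 = solCount p f β 0) :
    (p : ℤ) * wtOn p (Dzero p f) β = (p - 1) * (2 * p ^ (n - 1) - solCount p f β 0) := by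
  have hp : p.Prime := Fact.out
  have h1 := sum_solCount_mul p f β
  rw [← Finset.add_sum_erase _ _ (Finset.mem_univ (0 : ZMod p)),
    Finset.sum_congr rfl fun z hz => hscale z (Finset.ne_of_mem_erase hz), Finset.sum_const,
    Finset.card_erase_of_mem (Finset.mem_univ _), Finset.card_univ, ZMod.card, map_zero, zero_mul,
    h00, smul_eq_mul] at h1
  have h2 := wtOn_Dzero_add p f β
  rw [h00] at h2
  have h3 := card_trace_mul_ne_zero p n hn hq hβ
  have hpn : (p : ℤ) ^ n = p * p ^ (n - 1) := by
    rw [← pow_succ', Nat.sub_add_cancel hn]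
  zify [hp.one_le] at h1 h2
  rw [h3, hpn] at h1
  rw [show (wtOn p (Dzero p f) β : ℤ) = p ^ (n - 1) - (Finset.univ.filter fun x => f x = 0 ∧
    Algebra.trace (ZMod p) F (β * x) = 0).card by linarith]
  linarith

theorem cword_apply_sub_mul (p : ℕ) [Fact p.Prime] {F : Type*} [Field F] [Fintype F]
    [Algebra (ZMod p) F] (a : ZMod p) (β β' x : F) :
    Algebra.trace (ZMod p) F ((β' - algebraMap (ZMod p) F a * β) * x) =
      Algebra.trace (ZMod p) F (β' * x) - a * Algebra.trace (ZMod p) F (β * x) := by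
  rw [sub_mul, map_sub, mul_assoc, ← Algebra.smul_def, map_smul, smul_eq_mul]

/-- If `c_β` covers `c_β'`, the weights of the words `c_β' - a c_β` add up to
`(p - 1) wt(c_β) - wt(c_β')`. -/
theorem sum_wtOn_sub_mul (p : ℕ) [Fact p.Prime] {F : Type*} [Field F] [Fintype F]
    [Algebra (ZMod p) F] (D : Finset F) (β β' : F)
    (hcov : Covers (cword p D β) (cword p D β')) :
    ∑ a ∈ Finset.univ.erase (0 : ZMod p), wtOn p D (β' - algebraMap (ZMod p) F a * β) +
      wtOn p D β' = (p - 1) * wtOn p D β := by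
  have hp : p.Prime := Fact.out
  simp only [wtOn, Finset.card_filter, cword_apply_sub_mul]
  rw [Finset.sum_comm, ← Finset.sum_add_distrib, Finset.mul_sum]
  refine Finset.sum_congr rfl fun x hx => ?_
  have hx' := hcov ⟨x, hx⟩
  simp only [cword] at hx'
  have hcard : (Finset.univ.erase (0 : ZMod p)).card = p - 1 := by
    rw [Finset.card_erase_of_mem (Finset.mem_univ _), Finset.card_univ, ZMod.card]
  generalize Algebra.trace (ZMod p) F (β' * x) = t' at *
  generalize Algebra.trace (ZMod p) F (β * x) = t at *
  by_cases ht' : t' = 0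
  · subst ht'
    by_cases ht : t = 0
    · simp [ht]
    · rw [Finset.sum_congr rfl (g := fun _ => 1)]
      · simp [ht]
      · intro a ha
        simp [ht, Finset.ne_of_mem_erase ha]
  · have ht := hx' ht'
    have hmem : t' / t ∈ Finset.univ.erase (0 : ZMod p) := by simp [ht, ht']
    rw [← Finset.add_sum_erase _ _ hmem, Finset.sum_congr rfl (g := fun _ => 1)]
    · have := hp.two_le
      simp [ht, ht']
      omega
    · intro a ha
      rw [if_pos]
      intro h
      exact Finset.ne_of_mem_erase ha (by rw [eq_div_iff ht, sub_eq_zero.mp h])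

theorem cword_eq_zero_of_wtOn (p : ℕ) {F : Type*} [Field F] [Fintype F]
    [Algebra (ZMod p) F] (D : Finset F) (β : F) : cword p D β = 0 ↔ wtOn p D β = 0 := by
  simp only [wtOn, Finset.card_eq_zero, Finset.filter_eq_empty_iff, not_not, funext_iff, cword,
    Subtype.forall, Pi.zero_apply]

/-- The Ashikhmin–Barg criterion for minimality. -/
theorem isMinimalCode_of_weight_bounds (p : ℕ) [Fact p.Prime] {F : Type*} [Field F] [Fintype F]
    [Algebra (ZMod p) F] (D : Finset F) (wmin wmax : ℕ)
    (hmin : ∀ β, cword p D β ≠ 0 → wmin ≤ wtOn p D β)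
    (hmax : ∀ β, wtOn p D β ≤ wmax) (h : (p - 1) * wmax < p * wmin) : IsMinimalCode p D := by
  have hp : p.Prime := Fact.out
  intro β _ β' hβ' hcov
  by_contra! hne
  have hsum := sum_wtOn_sub_mul p D β β' hcov
  have hlow : (p - 1) * wmin ≤
      ∑ a ∈ Finset.univ.erase (0 : ZMod p), wtOn p D (β' - algebraMap (ZMod p) F a * β) := by
    have := Finset.card_nsmul_le_sum (Finset.univ.erase (0 : ZMod p))
      (fun a => wtOn p D (β' - algebraMap (ZMod p) F a * β)) wmin fun a ha =>
        hmin _ fun h0 => hne a (Finset.ne_of_mem_erase ha) ?_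
    · rwa [Finset.card_erase_of_mem (Finset.mem_univ _), Finset.card_univ, ZMod.card,
        smul_eq_mul] at this
    · funext d
      have := congrFun h0 d
      simp only [cword, cword_apply_sub_mul, Pi.zero_apply] at this
      simpa [cword] using sub_eq_zero.mp this
  have h1 := hmin β' hβ'
  have h2 := Nat.mul_le_mul_left (p - 1) (hmax β)
  have h3 : p * wmin = (p - 1) * wmin + wmin := by
    conv_lhs => rw [← Nat.sub_add_cancel hp.one_le]
    ring
  omega

theorem statement_16 (p n s : ℕ) [Fact p.Prime] (hp : p ≠ 2) (hn : 0 < n) (hs : s ≤ n)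
    {F : Type*} [Field F] [Fintype F] [Algebra (ZMod p) F]
    (hq : Fintype.card F = p ^ n)
    (f g : F → ZMod p) (ε : ℂ)
    (hf : IsWRP p n s f ε g)
    (hodd : Odd (n + s)) (hcond : s + 5 ≤ n) :
    IsMinimalCode p (Dzero p f) ∧
    HasParams p (Dzero p f)
      ((p : ℤ) ^ (n - 1) - 1)
      (((p : ℤ) - 1) * ((p : ℤ) ^ (n - 2) - (p : ℤ) ^ ((n + s - 3) / 2))) := by
  obtain ⟨⟨hε, hW, -⟩, hW0, hf0, h, h0, heven, hgcd, hhom⟩ := hf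
  have hpr : p.Prime := Fact.out
  obtain ⟨k, hk⟩ : ∃ k, n + s = 2 * (k + 1) + 1 := by
    obtain ⟨r, hr⟩ := hodd
    exact ⟨r - 1, by omega⟩
  have hk' : (n + s - 3) / 2 = k := by omega
  rw [hk']
  rw [hk] at hW
  have hneg : ∀ x, f (-x) = f x := by
    intro x
    simpa [heven.neg_one_pow] using hhom (-1) x
  have hscale := solCount_mul_eq p h f h0 hgcd hhom
  have h00 := solCount_zero_zero p n (k + 1) hp hn hq f hf0 hneg ε hε (g 0) (hW 0 hW0)
  set A : ℤ := (p : ℤ) ^ (n - 2) with hA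
  set B : ℤ := (p : ℤ) ^ k with hB
  have hpA : (p : ℤ) ^ (n - 1) = p * A := by
    rw [hA, ← pow_succ']
    congr 1
    omega
  have hpB : (p : ℤ) ^ (k + 1) = p * B := pow_succ' _ _
  have hp2 : (2 : ℤ) ≤ p := by exact_mod_cast hpr.two_le
  have hB0 : 0 < B := pow_pos (by linarith) _
  have hAB : (p : ℤ) ^ 2 * B ≤ A := by
    rw [hA, hB, ← pow_add]
    exact pow_le_pow_right₀ (by linarith) (by omega)
  have hcount : ∀ β, ∃ κ : ℤ, (κ = 0 ∨ κ = 1 ∨ κ = -1) ∧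
      (solCount p f β 0 : ℤ) = p * A + κ * (p * B) := by
    intro β
    rw [← hpA, ← hpB]
    by_cases hβ : walsh p f β = 0
    · exact ⟨0, Or.inl rfl, by simpa using solCount_of_walsh_eq_zero p n hn hq f β hβ 0⟩
    · obtain ⟨δ, hδ, hc⟩ := solCount_of_walsh_eq p n (k + 1) hp hn hq f β ε hε (g β) (hW β hβ)
      refine ⟨δ * quadraticChar (ZMod p) (0 - g β), ?_, by rw [hc 0]; ring⟩
      rcases quadraticChar_isQuadratic (ZMod p) (0 - g β) with h | h | h <;>
        rcases hδ with hδ | hδ <;> rw [h, hδ] <;> decide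
  have hwt : ∀ β, β ≠ 0 → ∀ κ : ℤ, (solCount p f β 0 : ℤ) = p * A + κ * (p * B) →
      (wtOn p (Dzero p f) β : ℤ) = (p - 1) * (A - κ * B) := by
    intro β hβ κ hκ
    have := mul_wtOn_Dzero p n hn hq f h00 β hβ fun z hz => hscale z hz β
    rw [hκ, hpA] at this
    refine mul_left_cancel₀ (show (p : ℤ) ≠ 0 by linarith) ?_
    rw [this]
    ring
  have hbounds : ∀ β, β ≠ 0 → ((p : ℤ) - 1) * (A - B) ≤ wtOn p (Dzero p f) β ∧
      (wtOn p (Dzero p f) β : ℤ) ≤ (p - 1) * (A + B) := by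
    intro β hβ
    obtain ⟨κ, hκ, hc⟩ := hcount β
    rw [hwt β hβ κ hc]
    constructor <;> refine mul_le_mul_of_nonneg_left ?_ (by linarith) <;>
      rcases hκ with rfl | rfl | rfl <;> linarith
  have hBA : (2 * p - 1) * B < A := by nlinarith [mul_pos hB0 (show (0 : ℤ) < (p - 1) ^ 2 by
    exact pow_pos (by linarith) 2)]
  have hBA' : B < A := by nlinarith
  have hne : ∀ β, cword p (Dzero p f) β ≠ 0 ↔ β ≠ 0 := by
    intro β
    constructor
    · rintro hβ rfl
      exact hβ (by funext d; simp [cword])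
    · intro hβ h
      rw [cword_eq_zero_of_wtOn] at h
      have := (hbounds β hβ).1
      rw [h] at this
      have : 0 < ((p : ℤ) - 1) * (A - B) := mul_pos (by linarith) (by linarith)
      push_cast at *
      linarith
  refine ⟨?_, ?_, ?_, ?_, ?_⟩
  · obtain ⟨wmin, hmin⟩ := Int.eq_ofNat_of_zero_le
      (show 0 ≤ ((p : ℤ) - 1) * (A - B) from mul_nonneg (by linarith) (by linarith))
    obtain ⟨wmax, hmax⟩ := Int.eq_ofNat_of_zero_le
      (show 0 ≤ ((p : ℤ) - 1) * (A + B) from mul_nonneg (by linarith) (by linarith))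
    refine isMinimalCode_of_weight_bounds p _ wmin wmax (fun β hβ => ?_) (fun β => ?_) ?_
    · have := (hbounds β ((hne β).mp hβ)).1
      rw [hmin] at this
      exact_mod_cast this
    · by_cases hβ : β = 0
      · rw [(cword_eq_zero_of_wtOn p _ β).mp (not_not.mp fun h => (hne β).mp h hβ)]
        exact Nat.zero_le _
      · have := (hbounds β hβ).2
        rw [hmax] at this
        exact_mod_cast this
    · zify [hpr.one_le]
      rw [← hmin, ← hmax]
      have : 0 < ((p : ℤ) - 1) * (A - (2 * p - 1) * B) := mul_pos (by linarith) (by linarith)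
      linarith
  · have := card_Dzero_add_one p f hf0
    rw [h00] at this
    zify at this
    linarith
  · intro β β' hββ'
    by_contra hcon
    refine (hne (β - β')).mpr (sub_ne_zero.mpr hcon) ?_
    funext d
    have := congrFun hββ' d
    simp only [cword] at this
    simp [cword, sub_mul, this]
  · exact fun β hβ => (hbounds β ((hne β).mp hβ)).1
  · obtain ⟨β, hβ⟩ := exists_lt_solCount p n hn hq f hf0
    have hβ0 : β ≠ 0 := by
      rintro rfl
      omega
    obtain ⟨κ, hκ, hc⟩ := hcount β
    zify at hβ
    rw [hc, hpA] at hβ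
    have hpB0 : 0 < (p : ℤ) * B := mul_pos (by linarith) hB0
    refine ⟨β, (hne β).mpr hβ0, ?_⟩
    rw [hwt β hβ0 κ hc]
    rcases hκ with rfl | rfl | rfl
    · linarith
    · ring
    · linarith
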